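/- arXiv:2407.06905 — 2 statements merged into one kernel-verified Lean document; each statement's English description precedes it below -/
import Mathlib

section
/- Let α ∈ (0,3). There exists a constant C = C(α) > 0 such that for all measurable functions u, v, φ, ψ : ℝ³ → ℝ, ∫_{ℝ³} ∫_{ℝ³} |u(y)|^{6−α} |v(x)|^{3−α} φ(x)² |ψ(x)| |x−y|^{−α} dx dy ≤ C ‖u‖_{L⁶}^{6−α} ‖v‖_{L⁶}^{3−α} ‖φ‖_{L⁶}² ‖ψ‖_{L⁶}. -/
open MeasureTheory Set Filter ENNReal

noncomputable section

/-- `ℝ³` as a Euclidean space. -/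
abbrev E3 : Type := EuclideanSpace ℝ (Fin 3)

/-- The `L⁶(ℝ³)` norm `(∫ |f|⁶)^{1/6}`, valued in `[0,∞]`. -/
noncomputable def L6norm (f : E3 → ℝ) : ℝ≥0∞ :=
  (∫⁻ x : E3, (‖f x‖₊ : ℝ≥0∞) ^ (6 : ℝ)) ^ ((1 : ℝ)/6)

/-- Scaling of the power kernel. -/
lemma hls_scale (β R : ℝ) (hR : 0 < R) (S : Set E3) (hS : MeasurableSet S) :
    ∫⁻ z in S, ‖z‖ₑ ^ (-β) =
      ENNReal.ofReal R ^ (3 - β) * ∫⁻ z in (fun z : E3 => R • z) ⁻¹' S, ‖z‖ₑ ^ (-β) := by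
  have hm : Measurable (fun z : E3 => R • z) := measurable_const_smul R
  have hmap := Measure.map_addHaar_smul (volume : Measure E3) hR.ne'
  have hfr : Module.finrank ℝ E3 = 3 := by simp [E3]
  rw [hfr] at hmap
  have hR0 : ENNReal.ofReal R ≠ 0 := by simpa using hR
  have hRt : ENNReal.ofReal R ≠ ⊤ := ENNReal.ofReal_ne_top
  have hF : Measurable (S.indicator (fun z : E3 => ‖z‖ₑ ^ (-β))) := by
    apply Measurable.indicator _ hS
    fun_prop
  have h1 : ∫⁻ z, S.indicator (fun z : E3 => ‖z‖ₑ ^ (-β)) (R • z)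
      = ENNReal.ofReal R ^ (-3 : ℝ) * ∫⁻ z in S, ‖z‖ₑ ^ (-β) := by
    rw [← lintegral_indicator hS, ← lintegral_map hF hm, hmap, lintegral_smul_measure, smul_eq_mul]
    congr 1
    rw [abs_of_pos (by positivity), ENNReal.ofReal_rpow_of_pos hR, Real.rpow_neg hR.le]
    norm_num
  have h2 : ∫⁻ z, S.indicator (fun z : E3 => ‖z‖ₑ ^ (-β)) (R • z)
      = ENNReal.ofReal R ^ (-β) * ∫⁻ z in (fun z : E3 => R • z) ⁻¹' S, ‖z‖ₑ ^ (-β) := by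
    rw [← lintegral_indicator (hm hS), ← lintegral_const_mul' _ _
      (by simp [ENNReal.rpow_eq_top_iff, hR0, hRt])]
    congr 1
    ext z
    by_cases hz : R • z ∈ S
    · have hz' : z ∈ (fun z : E3 => R • z) ⁻¹' S := hz
      rw [indicator_of_mem hz, indicator_of_mem hz', enorm_smul]
      rw [Real.enorm_of_nonneg hR.le]
      rcases eq_or_ne (‖z‖ₑ) 0 with h0 | h0
      · rcases lt_trichotomy β 0 with hb | hb | hb
        · rw [h0, mul_zero, ENNReal.zero_rpow_of_pos (by linarith), mul_zero]
        · simp [hb]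
        · rw [h0, mul_zero, ENNReal.zero_rpow_of_neg (by linarith), ENNReal.mul_top]
          simp [ENNReal.rpow_eq_zero_iff, hR0, hRt]
      · exact ENNReal.mul_rpow_of_ne_zero hR0 h0 _
    · have hz' : z ∉ (fun z : E3 => R • z) ⁻¹' S := hz
      rw [indicator_of_notMem hz, indicator_of_notMem hz', mul_zero]
  rw [h1] at h2
  have h3 : ENNReal.ofReal R ^ (3 : ℝ) * (ENNReal.ofReal R ^ (-3 : ℝ) * ∫⁻ z in S, ‖z‖ₑ ^ (-β))
     = ∫⁻ z in S, ‖z‖ₑ ^ (-β) := by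
    rw [← mul_assoc, ← ENNReal.rpow_add _ _ hR0 hRt]; simp
  rw [← h3, h2, ← mul_assoc, ← ENNReal.rpow_add _ _ hR0 hRt]
  rfl

lemma hls_near (α : ℝ) (hα : α ∈ Set.Ioo (0 : ℝ) 3) :
    ∫⁻ z in Metric.ball (0 : E3) 1, ‖z‖ₑ ^ (-α) < ⊤ := by
  have h := integrableOn_fun_norm_addHaar (volume : Measure E3) (f := fun r : ℝ => r ^ (-α)) (r := 1)
  have hfr : Module.finrank ℝ E3 = 3 := by simp [E3]
  rw [hfr] at h
  have h2 : IntegrableOn (fun y : ℝ => y ^ (3 - 1) • y ^ (-α)) (Ioo 0 1) := by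
    have := (intervalIntegral.integrableOn_Ioo_rpow_iff (s := 2 - α) zero_lt_one).2
      (by linarith [hα.2])
    refine this.congr_fun (fun y hy => ?_) measurableSet_Ioo
    dsimp only
    rw [sub_eq_add_neg, Real.rpow_add hy.1]
    norm_num
  have h3 := (h.2 h2).hasFiniteIntegral
  unfold HasFiniteIntegral at h3
  refine lt_of_eq_of_lt ?_ h3
  apply lintegral_congr_ae
  have : ∀ᵐ z : E3, z ≠ 0 := by simp [ae_iff]
  filter_upwards [ae_restrict_of_ae this] with z hz
  have hp : 0 < ‖z‖ := norm_pos_iff.2 hz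
  rw [Real.enorm_of_nonneg (by positivity), ← ENNReal.ofReal_rpow_of_pos hp, ofReal_norm]

lemma hls_far :
    ∫⁻ z in (Metric.ball (0 : E3) 1)ᶜ, ‖z‖ₑ ^ (-6 : ℝ) < ⊤ := by
  have h := finite_integral_one_add_norm (E := E3) (μ := volume) (r := 6) (by simp [E3]; norm_num)
  refine lt_of_le_of_lt ?_ (ENNReal.mul_lt_top (a := ENNReal.ofReal (2 ^ (6 : ℝ))) (by simp) h)
  rw [← lintegral_const_mul' _ _ (by simp)]
  refine le_trans ?_ (setLIntegral_le_lintegral (Metric.ball (0 : E3) 1)ᶜ _)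
  apply setLIntegral_mono' measurableSet_ball.compl
  intro z hz
  have hz1 : 1 ≤ ‖z‖ := by simpa using hz
  have hp : 0 < ‖z‖ := by linarith
  rw [← ofReal_norm, ENNReal.ofReal_rpow_of_pos hp, ← ENNReal.ofReal_mul (by positivity)]
  apply ENNReal.ofReal_le_ofReal
  rw [Real.rpow_neg hp.le, Real.rpow_neg (by positivity), ← div_eq_mul_inv,
    ← Real.div_rpow (by norm_num) (by positivity), ← Real.inv_rpow hp.le]
  apply Real.rpow_le_rpow (by positivity) _ (by norm_num)
  rw [inv_eq_one_div, div_le_div_iff₀ hp (by positivity)]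
  linarith

/-- Pointwise bound of the potential of a bounded function in the unit ball of `L^p`. -/
lemma hls_potential (α : ℝ) (hα : α ∈ Set.Ioo (0 : ℝ) 3) :
    ∃ C : ℝ≥0∞, C ≠ ⊤ ∧ 1 ≤ C ∧ ∀ (g : E3 → ℝ≥0∞) (t : ℝ≥0∞) (y : E3), Measurable g →
      ∫⁻ x, g x ^ (6 / (6 - α)) ≤ 1 → (∀ x, g x ≤ t) →
      ∫⁻ x, g x * ‖x - y‖ₑ ^ (-α) ≤ C * t ^ (6 / (6 - α) - 1) := by
  obtain ⟨h0, h3⟩ := hα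
  have h6 : 0 < 6 - α := by linarith
  have hp1 : 0 < 6 / (6 - α) - 1 := by
    rw [sub_pos, lt_div_iff₀ h6]; linarith
  set A := ∫⁻ z in Metric.ball (0 : E3) 1, ‖z‖ₑ ^ (-α) with hA
  set B := ∫⁻ z in (Metric.ball (0 : E3) 1)ᶜ, ‖z‖ₑ ^ (-6 : ℝ) with hB
  have hAt : A ≠ ⊤ := (hls_near α ⟨h0, h3⟩).ne
  have hBt : B ≠ ⊤ := hls_far.ne
  refine ⟨A + B ^ (α / 6) + 1, ?_, by simp, ?_⟩
  · simp [hAt, hBt, ENNReal.rpow_eq_top_iff]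
    intro _; linarith
  intro g t y hg hgp hgt
  rcases eq_or_ne t 0 with rfl | ht0
  · have : ∀ x, g x = 0 := fun x => le_antisymm (hgt x) bot_le
    simp [this]
  rcases eq_or_ne t ⊤ with rfl | htt
  · rw [ENNReal.top_rpow_of_pos hp1, ENNReal.mul_top (by simp)]
    exact le_top
  set s := t.toReal with hs
  have hs0 : 0 < s := ENNReal.toReal_pos ht0 htt
  have hts : t = ENNReal.ofReal s := (ENNReal.ofReal_toReal htt).symm
  set R := s ^ (-(2 / (6 - α))) with hR
  have hR0 : 0 < R := by positivity
  have htr : ∫⁻ x, g x * ‖x - y‖ₑ ^ (-α) = ∫⁻ z, g (z + y) * ‖z‖ₑ ^ (-α) := by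
    rw [← lintegral_add_right_eq_self _ y]
    simp
  have hg' : Measurable (fun z => g (z + y)) := hg.comp (measurable_add_const y)
  rw [htr, ← lintegral_add_compl _ (measurableSet_ball (x := (0 : E3)) (ε := R))]
  have e1 : (fun z : E3 => R • z) ⁻¹' Metric.ball 0 R = Metric.ball 0 1 := by
    ext z
    simp [norm_smul, abs_of_pos hR0]
    rw [mul_lt_iff_lt_one_right hR0]
  have e2 : (fun z : E3 => R • z) ⁻¹' (Metric.ball 0 R)ᶜ = (Metric.ball 0 1)ᶜ := by
    rw [preimage_compl, e1]
  have b1 : ∫⁻ z in Metric.ball (0 : E3) R, g (z + y) * ‖z‖ₑ ^ (-α)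
      ≤ A * t ^ (6 / (6 - α) - 1) := by
    calc _ ≤ ∫⁻ z in Metric.ball (0 : E3) R, t * ‖z‖ₑ ^ (-α) := by
          apply lintegral_mono; intro z; dsimp only; gcongr; exact hgt _
      _ = t * (ENNReal.ofReal R ^ (3 - α) * A) := by
          rw [lintegral_const_mul' _ _ htt, hls_scale α R hR0 _ measurableSet_ball, e1]
      _ = A * t ^ (6 / (6 - α) - 1) := by
          rw [← mul_assoc, mul_comm]
          congr 1
          rw [hts, ENNReal.ofReal_rpow_of_pos hR0, ENNReal.ofReal_rpow_of_pos hs0,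
            ← ENNReal.ofReal_mul hs0.le, hR, ← Real.rpow_mul hs0.le]
          congr 1
          nth_rewrite 1 [← Real.rpow_one s]
          rw [← Real.rpow_add hs0]
          congr 1
          field_simp
          ring
  have b2 : ∫⁻ z in (Metric.ball (0 : E3) R)ᶜ, g (z + y) * ‖z‖ₑ ^ (-α)
      ≤ B ^ (α / 6) * t ^ (6 / (6 - α) - 1) := by
    have hconj : (6 / (6 - α)).HolderConjugate (6 / α) := by
      rw [Real.holderConjugate_iff]
      constructor
      · linarith
      · field_simp; ring
    have hH := ENNReal.lintegral_mul_le_Lp_mul_Lq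
      ((volume : Measure E3).restrict (Metric.ball (0 : E3) R)ᶜ) hconj
      (f := fun z => g (z + y)) (g := fun z => ‖z‖ₑ ^ (-α)) hg'.aemeasurable (by fun_prop)
    refine hH.trans ?_
    have c1 : ∫⁻ z in (Metric.ball (0 : E3) R)ᶜ, g (z + y) ^ (6 / (6 - α)) ≤ 1 := by
      refine (setLIntegral_le_lintegral _ _).trans ?_
      rw [lintegral_add_right_eq_self (fun z => g z ^ (6 / (6 - α))) y]
      exact hgp
    have c2 : ∫⁻ z in (Metric.ball (0 : E3) R)ᶜ, (‖z‖ₑ ^ (-α)) ^ (6 / α)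
        = ENNReal.ofReal R ^ (-3 : ℝ) * B := by
      have : ∀ z : E3, (‖z‖ₑ ^ (-α)) ^ (6 / α) = ‖z‖ₑ ^ (-6 : ℝ) := by
        intro z
        rw [← ENNReal.rpow_mul]
        congr 1
        field_simp
      simp_rw [this]
      rw [hls_scale 6 R hR0 _ measurableSet_ball.compl, e2]
      norm_num
      rfl
    rw [c2]
    calc _ ≤ (1 : ℝ≥0∞) ^ (1 / (6 / (6 - α))) * (ENNReal.ofReal R ^ (-3 : ℝ) * B) ^ (1 / (6 / α)) := by
          gcongr
      _ = _ := by
          rw [ENNReal.one_rpow, one_mul, one_div_div, ENNReal.mul_rpow_of_nonneg _ _ (by positivity),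
            mul_comm]
          congr 1
          rw [hts, ENNReal.ofReal_rpow_of_pos hR0, ENNReal.ofReal_rpow_of_pos (by positivity),
            ENNReal.ofReal_rpow_of_pos hs0, hR, ← Real.rpow_mul hs0.le, ← Real.rpow_mul hs0.le]
          congr 2
          field_simp
          ring
  calc _ ≤ A * t ^ (6 / (6 - α) - 1) + B ^ (α / 6) * t ^ (6 / (6 - α) - 1) := add_le_add b1 b2
    _ ≤ _ := by
      rw [← add_mul]
      exact mul_le_mul' le_self_add le_rfl

lemma hls_half (α : ℝ) (hα : α ∈ Set.Ioo (0 : ℝ) 3) (C : ℝ≥0∞) (hCt : C ≠ ⊤)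
    (hC : ∀ (g : E3 → ℝ≥0∞) (t : ℝ≥0∞) (y : E3), Measurable g →
      ∫⁻ x, g x ^ (6 / (6 - α)) ≤ 1 → (∀ x, g x ≤ t) →
      ∫⁻ x, g x * ‖x - y‖ₑ ^ (-α) ≤ C * t ^ (6 / (6 - α) - 1))
    (f g : E3 → ℝ≥0∞) (hg : Measurable g)
    (hfp : ∫⁻ x, f x ^ (6 / (6 - α)) ≤ 1) (hgp : ∫⁻ x, g x ^ (6 / (6 - α)) ≤ 1) :
    ∫⁻ y, ∫⁻ x, f y * ({x | g x ≤ f y}.indicator g x * ‖x - y‖ₑ ^ (-α)) ≤ C := by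
  obtain ⟨h0, h3⟩ := hα
  have h6 : 0 < 6 - α := by linarith
  have hp1 : 0 < 6 / (6 - α) - 1 := by
    rw [sub_pos, lt_div_iff₀ h6]; linarith
  calc _ ≤ ∫⁻ y, C * f y ^ (6 / (6 - α)) := by
        apply lintegral_mono
        intro y
        dsimp only
        have hm : Measurable ({x | g x ≤ f y}.indicator g) :=
          hg.indicator (measurableSet_le hg measurable_const)
        rw [lintegral_const_mul _ (by fun_prop)]
        have := hC ({x | g x ≤ f y}.indicator g) (f y) y hm ?_ ?_
        · calc _ ≤ f y * (C * f y ^ (6 / (6 - α) - 1)) := by gcongr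
            _ = C * (f y ^ (1 : ℝ) * f y ^ (6 / (6 - α) - 1)) := by rw [ENNReal.rpow_one]; ring
            _ = _ := by
              rw [← ENNReal.rpow_add_of_nonneg _ _ zero_le_one hp1.le]
              congr 2; ring
        · refine (lintegral_mono fun x => ?_).trans hgp
          dsimp only
          gcongr
          exact indicator_le_self _ _ x
        · intro x
          exact indicator_le' (fun x hx => hx) (fun _ _ => bot_le) x
    _ = C * ∫⁻ y, f y ^ (6 / (6 - α)) := lintegral_const_mul' _ _ hCt
    _ ≤ C * 1 := by gcongr
    _ = C := mul_one _

lemma hls_unit (α : ℝ) (hα : α ∈ Set.Ioo (0 : ℝ) 3) :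
    ∃ C : ℝ≥0∞, C ≠ ⊤ ∧ 1 ≤ C ∧ ∀ f g : E3 → ℝ≥0∞, Measurable f → Measurable g →
      ∫⁻ x, f x ^ (6 / (6 - α)) ≤ 1 → ∫⁻ x, g x ^ (6 / (6 - α)) ≤ 1 →
      ∫⁻ y, ∫⁻ x, f y * g x * ‖x - y‖ₑ ^ (-α) ≤ C := by
  obtain ⟨C, hCt, hC1, hC⟩ := hls_potential α hα
  refine ⟨C + C, by simp [hCt], hC1.trans (by simp), ?_⟩
  intro f g hf hg hfp hgp
  have H1 := hls_half α hα C hCt hC f g hg hfp hgp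
  have H2 := hls_half α hα C hCt hC g f hf hgp hfp
  have m1 : Measurable (fun q : E3 × E3 =>
      f q.1 * ({x | g x ≤ f q.1}.indicator g q.2 * ‖q.2 - q.1‖ₑ ^ (-α))) := by
    have : Measurable (fun q : E3 × E3 => {q : E3 × E3 | g q.2 ≤ f q.1}.indicator
        (fun q => g q.2) q) :=
      (hg.comp measurable_snd).indicator
        (measurableSet_le (hg.comp measurable_snd) (hf.comp measurable_fst))
    have h2 : Measurable (fun q : E3 × E3 => {x | g x ≤ f q.1}.indicator g q.2) := this
    fun_prop
  have m2 : Measurable (fun q : E3 × E3 =>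
      g q.1 * ({x | f x ≤ g q.1}.indicator f q.2 * ‖q.2 - q.1‖ₑ ^ (-α))) := by
    have : Measurable (fun q : E3 × E3 => {q : E3 × E3 | f q.2 ≤ g q.1}.indicator
        (fun q => f q.2) q) :=
      (hf.comp measurable_snd).indicator
        (measurableSet_le (hf.comp measurable_snd) (hg.comp measurable_fst))
    have h2 : Measurable (fun q : E3 × E3 => {x | f x ≤ g q.1}.indicator f q.2) := this
    fun_prop
  rw [lintegral_lintegral_swap m2.aemeasurable] at H2
  calc _ ≤ ∫⁻ y, ((∫⁻ x, f y * ({x | g x ≤ f y}.indicator g x * ‖x - y‖ₑ ^ (-α))) +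
        ∫⁻ x, g x * ({z | f z ≤ g x}.indicator f y * ‖y - x‖ₑ ^ (-α))) := by
        apply lintegral_mono
        intro y
        dsimp only
        have my : Measurable (fun x => f y * ({x | g x ≤ f y}.indicator g x * ‖x - y‖ₑ ^ (-α))) :=
          m1.comp (measurable_prodMk_left (x := y))
        rw [← lintegral_add_left my]
        apply lintegral_mono
        intro x
        dsimp only
        rcases le_total (g x) (f y) with h | h
        · rw [indicator_of_mem (s := {x | g x ≤ f y}) (by exact h), mul_assoc]
          exact le_self_add
        · rw [indicator_of_mem (s := {z | f z ≤ g x}) (by exact h), enorm_sub_rev y x,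
            mul_comm (f y), mul_assoc]
          exact le_add_self
    _ = _ := lintegral_add_left m1.lintegral_prod_right' _
    _ ≤ C + C := add_le_add H1 H2

/-- Hardy–Littlewood–Sobolev inequality, diagonal case. -/
lemma hls_diag (α : ℝ) (hα : α ∈ Set.Ioo (0 : ℝ) 3) :
    ∃ C : ℝ≥0∞, C ≠ ⊤ ∧ 1 ≤ C ∧ ∀ f g : E3 → ℝ≥0∞, Measurable f → Measurable g →
      ∫⁻ y, ∫⁻ x, f y * g x * ‖x - y‖ₑ ^ (-α) ≤
        C * (∫⁻ x, f x ^ (6 / (6 - α))) ^ ((6 - α) / 6) *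
          (∫⁻ x, g x ^ (6 / (6 - α))) ^ ((6 - α) / 6) := by
  obtain ⟨C, hCt, hC1, hC⟩ := hls_unit α hα
  obtain ⟨h0, h3⟩ := hα
  have h6 : 0 < 6 - α := by linarith
  have hp : 0 < 6 / (6 - α) := by positivity
  have hq : 0 < (6 - α) / 6 := by positivity
  have hC0 : C ≠ 0 := (lt_of_lt_of_le one_pos hC1).ne'
  refine ⟨C, hCt, hC1, ?_⟩
  intro f g hf hg
  set N := ∫⁻ x, f x ^ (6 / (6 - α)) with hN
  set M := ∫⁻ x, g x ^ (6 / (6 - α)) with hM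
  rcases eq_or_ne N 0 with hN0 | hN0
  · have := ENNReal.ae_eq_zero_of_lintegral_rpow_eq_zero hp.le hf.aemeasurable hN0
    refine le_of_eq_of_le (b := 0) ?_ bot_le
    rw [← lintegral_zero (μ := (volume : Measure E3))]
    apply lintegral_congr_ae
    filter_upwards [this] with y hy
    simp [hy]
  rcases eq_or_ne M 0 with hM0 | hM0
  · have := ENNReal.ae_eq_zero_of_lintegral_rpow_eq_zero hp.le hg.aemeasurable hM0
    refine le_of_eq_of_le (b := 0) ?_ bot_le
    rw [← lintegral_zero (μ := (volume : Measure E3))]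
    apply lintegral_congr
    intro y
    rw [← lintegral_zero (μ := (volume : Measure E3))]
    apply lintegral_congr_ae
    filter_upwards [this] with x hx
    simp [hx]
  have hNq : N ^ ((6 - α) / 6) ≠ 0 := by simp [ENNReal.rpow_eq_zero_iff, hN0, hq.le]
  have hMq : M ^ ((6 - α) / 6) ≠ 0 := by simp [ENNReal.rpow_eq_zero_iff, hM0, hq.le]
  rcases eq_or_ne N ⊤ with hNt | hNt
  · rw [hNt, ENNReal.top_rpow_of_pos hq, ENNReal.mul_top hC0, ENNReal.top_mul hMq]
    exact le_top
  rcases eq_or_ne M ⊤ with hMt | hMt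
  · rw [hMt, ENNReal.top_rpow_of_pos hq, ENNReal.mul_top (mul_ne_zero hC0 hNq)]
    exact le_top
  set a := N ^ ((6 - α) / 6) with ha
  set b := M ^ ((6 - α) / 6) with hb
  have hat : a ≠ ⊤ := ENNReal.rpow_ne_top_of_nonneg hq.le hNt
  have hbt : b ≠ ⊤ := ENNReal.rpow_ne_top_of_nonneg hq.le hMt
  have norm1 : ∀ (P : ℝ≥0∞) (h : E3 → ℝ≥0∞), P ≠ 0 → P ≠ ⊤ → Measurable h →
      ∫⁻ x, h x ^ (6 / (6 - α)) = P →
      ∫⁻ x, ((P ^ ((6 - α) / 6))⁻¹ * h x) ^ (6 / (6 - α)) ≤ 1 := by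
    intro P h hP0 hPt hh hP
    simp_rw [ENNReal.mul_rpow_of_nonneg _ _ hp.le]
    rw [lintegral_const_mul _ (by fun_prop), hP, ENNReal.inv_rpow, ← ENNReal.rpow_mul]
    have : (6 - α) / 6 * (6 / (6 - α)) = 1 := by field_simp
    rw [this, ENNReal.rpow_one, ENNReal.inv_mul_cancel hP0 hPt]
  have key := hC (fun y => a⁻¹ * f y) (fun x => b⁻¹ * g x) (by fun_prop) (by fun_prop)
    (norm1 N f hN0 hNt hf rfl) (norm1 M g hM0 hMt hg rfl)
  have hia : a⁻¹ ≠ ⊤ := by simpa using hNq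
  have hib : b⁻¹ ≠ ⊤ := by simpa using hMq
  have e : ∫⁻ y, ∫⁻ x, a⁻¹ * f y * (b⁻¹ * g x) * ‖x - y‖ₑ ^ (-α)
      = (a⁻¹ * b⁻¹) * ∫⁻ y, ∫⁻ x, f y * g x * ‖x - y‖ₑ ^ (-α) := by
    rw [← lintegral_const_mul' _ _ (ENNReal.mul_ne_top hia hib)]
    congr 1; ext y
    rw [← lintegral_const_mul' _ _ (ENNReal.mul_ne_top hia hib)]
    congr 1; ext x
    ring
  rw [e] at key
  set I := ∫⁻ y, ∫⁻ x, f y * g x * ‖x - y‖ₑ ^ (-α)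
  calc I = (a * a⁻¹) * (b * b⁻¹) * I := by
        rw [ENNReal.mul_inv_cancel hNq hat, ENNReal.mul_inv_cancel hMq hbt]; simp
    _ = a * b * ((a⁻¹ * b⁻¹) * I) := by ring
    _ ≤ a * b * C := by gcongr
    _ = C * a * b := by ring

/-- for `α ∈ (0,3)` there is `C = C(α) > 0` such that for all measurable
`u, v, φ, ψ : ℝ³ → ℝ`,
`∫∫ |u(y)|^{6−α}|v(x)|^{3−α} φ(x)² |ψ(x)| |x−y|^{−α} dx dy
  ≤ C ‖u‖₆^{6−α} ‖v‖₆^{3−α} ‖φ‖₆² ‖ψ‖₆` (in `[0,∞]`). -/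
theorem composite_hls_estimate_quadratic (α : ℝ) (hα : α ∈ Set.Ioo (0 : ℝ) 3) :
    ∃ C > 0, ∀ u v φ ψ : E3 → ℝ,
      Measurable u → Measurable v → Measurable φ → Measurable ψ →
      (∫⁻ y : E3, ∫⁻ x : E3,
          (‖u y‖₊ : ℝ≥0∞) ^ (6 - α) * (‖v x‖₊ : ℝ≥0∞) ^ (3 - α)
            * (‖φ x‖₊ : ℝ≥0∞) ^ (2 : ℝ) * (‖ψ x‖₊ : ℝ≥0∞) * (‖x - y‖₊ : ℝ≥0∞) ^ (-α))
        ≤ ENNReal.ofReal C * L6norm u ^ (6 - α) * L6norm v ^ (3 - α)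
            * L6norm φ ^ (2 : ℝ) * L6norm ψ := by
  obtain ⟨C, hCt, hC1, hC⟩ := hls_diag α hα
  obtain ⟨h0, h3⟩ := hα
  have h6 : 0 < 6 - α := by linarith
  have hp : 0 < 6 / (6 - α) := by positivity
  have hq : 0 < (6 - α) / 6 := by positivity
  refine ⟨C.toReal, ENNReal.toReal_pos (lt_of_lt_of_le one_pos hC1).ne' hCt, ?_⟩
  intro u v φ ψ hu hv hφ hψ
  rw [ENNReal.ofReal_toReal hCt]
  have key := hC (fun y => ‖u y‖ₑ ^ (6 - α))
    (fun x => ‖v x‖ₑ ^ (3 - α) * ‖φ x‖ₑ ^ (2 : ℝ) * ‖ψ x‖ₑ) (by fun_prop) (by fun_prop)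
  have hL : ∀ w : E3 → ℝ, L6norm w = (∫⁻ x, ‖w x‖ₑ ^ (6 : ℝ)) ^ ((1 : ℝ) / 6) := fun _ => rfl
  have e1 : (∫⁻ x, (‖u x‖ₑ ^ (6 - α)) ^ (6 / (6 - α))) ^ ((6 - α) / 6) = L6norm u ^ (6 - α) := by
    rw [hL, ← ENNReal.rpow_mul]
    have : ∀ x, (‖u x‖ₑ ^ (6 - α)) ^ (6 / (6 - α)) = ‖u x‖ₑ ^ (6 : ℝ) := by
      intro x
      rw [← ENNReal.rpow_mul]
      congr 1; field_simp
    simp_rw [this]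
    congr 1; ring
  have e2 : (∫⁻ x, (‖v x‖ₑ ^ (3 - α) * ‖φ x‖ₑ ^ (2 : ℝ) * ‖ψ x‖ₑ) ^ (6 / (6 - α))) ^ ((6 - α) / 6)
      ≤ L6norm v ^ (3 - α) * L6norm φ ^ (2 : ℝ) * L6norm ψ := by
    have hH := ENNReal.lintegral_prod_norm_pow_le (μ := (volume : Measure E3)) Finset.univ
      (f := ![fun x => ‖v x‖ₑ ^ (6 : ℝ), fun x => ‖φ x‖ₑ ^ (6 : ℝ), fun x => ‖ψ x‖ₑ ^ (6 : ℝ)])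
      (p := ![(3 - α) / (6 - α), 2 / (6 - α), 1 / (6 - α)])
      (by
        intro i _
        fin_cases i
        · exact (hv.enorm.pow_const _).aemeasurable
        · exact (hφ.enorm.pow_const _).aemeasurable
        · exact (hψ.enorm.pow_const _).aemeasurable)
      (by simp [Fin.sum_univ_three]; field_simp; ring)
      (by
        intro i _
        have : 0 ≤ 3 - α := by linarith
        fin_cases i
        · exact div_nonneg this h6.le
        · exact div_nonneg (by norm_num) h6.le
        · exact div_nonneg (by norm_num) h6.le)
    simp only [Fin.prod_univ_three, Matrix.cons_val_zero, Matrix.cons_val_one,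
      Matrix.cons_val] at hH
    have e3 : ∀ x, (‖v x‖ₑ ^ (3 - α) * ‖φ x‖ₑ ^ (2 : ℝ) * ‖ψ x‖ₑ) ^ (6 / (6 - α))
        = (‖v x‖ₑ ^ (6 : ℝ)) ^ ((3 - α) / (6 - α)) * (‖φ x‖ₑ ^ (6 : ℝ)) ^ (2 / (6 - α))
          * (‖ψ x‖ₑ ^ (6 : ℝ)) ^ (1 / (6 - α)) := by
      intro x
      rw [ENNReal.mul_rpow_of_nonneg _ _ hp.le, ENNReal.mul_rpow_of_nonneg _ _ hp.le]
      simp only [← ENNReal.rpow_mul]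
      have x1 : (3 - α) * (6 / (6 - α)) = 6 * ((3 - α) / (6 - α)) := by ring
      have x2 : 2 * (6 / (6 - α)) = 6 * (2 / (6 - α)) := by ring
      have x3 : 6 / (6 - α) = 6 * (1 / (6 - α)) := by ring
      rw [x1, x2, ← x3]
    simp_rw [e3]
    refine (ENNReal.rpow_le_rpow hH hq.le).trans (le_of_eq ?_)
    rw [ENNReal.mul_rpow_of_nonneg _ _ hq.le, ENNReal.mul_rpow_of_nonneg _ _ hq.le]
    simp only [hL, ← ENNReal.rpow_mul]
    have x1 : (3 - α) / (6 - α) * ((6 - α) / 6) = 1 / 6 * (3 - α) := by field_simp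
    have x2 : 2 / (6 - α) * ((6 - α) / 6) = 1 / 6 * 2 := by field_simp
    have x3 : 1 / (6 - α) * ((6 - α) / 6) = 1 / 6 := by field_simp
    rw [x1, x2, x3]
  calc _ = ∫⁻ y, ∫⁻ x, ‖u y‖ₑ ^ (6 - α) * (‖v x‖ₑ ^ (3 - α) * ‖φ x‖ₑ ^ (2 : ℝ) * ‖ψ x‖ₑ)
            * ‖x - y‖ₑ ^ (-α) := by
        congr 1; ext y; congr 1; ext x
        simp only [← enorm_eq_nnnorm]
        ring
    _ ≤ _ := key
    _ ≤ C * L6norm u ^ (6 - α) * (L6norm v ^ (3 - α) * L6norm φ ^ (2 : ℝ) * L6norm ψ) := by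
        rw [e1]; gcongr
    _ = _ := by ring

end
end

section
/- Let α ∈ (0,3). There exists a constant C = C(α) > 0 such that for all measurable functions u, φ, ψ : ℝ³ → ℝ, ∫_{ℝ³} ∫_{ℝ³} |u(y)|^{5−α} |φ(y)| |u(x)|^{4−α} |φ(x)| |ψ(x)| |x−y|^{−α} dx dy ≤ C ‖u‖_{L⁶}^{9−2α} ‖φ‖_{L⁶}² ‖ψ‖_{L⁶}. -/
open MeasureTheory Set Filter ENNReal

noncomputable section

/-- The integrable majorant profile. -/
def hlsK (a ρ : ℝ) : ℝ := if ρ ≤ 1 then ρ ^ (-(6 * a)) else ρ ^ (-6 : ℝ)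

lemma hlsK_measurable (a : ℝ) : Measurable (hlsK a) := by
  unfold hlsK
  exact Measurable.ite measurableSet_Iic (by fun_prop) (by fun_prop)

lemma hlsK_nonneg (a ρ : ℝ) (h : 0 ≤ ρ) : 0 ≤ hlsK a ρ := by
  unfold hlsK
  split_ifs <;> positivity

lemma hls_pt_aux (a F G d : ℝ) (ha : 0 < a) (ha2 : a < 1/2) (hF : 0 < F) (hG : 0 < G)
    (hd : 0 < d) (hFG : F ≤ G) :
    F ^ (1 - a) * G ^ (1 - a) * d ^ (-(6 * a)) ≤
      F * G + G ^ 2 * hlsK a (G ^ (1/3 : ℝ) * d) := by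
  have hd6 : (d ^ (6:ℝ)) ^ (-a) = d ^ (-(6 * a)) := by
    rw [← Real.rpow_mul hd.le]; congr 1; ring
  have hd60 : 0 < d ^ (6:ℝ) := by positivity
  have hK := hlsK_nonneg a (G ^ (1/3 : ℝ) * d) (by positivity)
  rcases le_or_gt 1 (F * G * d ^ (6:ℝ)) with h1 | h1
  · have e : F ^ (1 - a) * G ^ (1 - a) * d ^ (-(6 * a)) = F * G * (F * G * d ^ (6:ℝ)) ^ (-a) := by
      rw [Real.mul_rpow (by positivity) hd60.le, Real.mul_rpow hF.le hG.le, hd6,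
        sub_eq_add_neg, Real.rpow_add hF, Real.rpow_add hG, Real.rpow_one, Real.rpow_one]
      ring
    rw [e]
    have : (F * G * d ^ (6:ℝ)) ^ (-a) ≤ 1 := Real.rpow_le_one_of_one_le_of_nonpos h1 (by linarith)
    have h2 : F * G * (F * G * d ^ (6:ℝ)) ^ (-a) ≤ F * G * 1 := by gcongr
    have : 0 ≤ G ^ 2 * hlsK a (G ^ (1/3 : ℝ) * d) := by positivity
    linarith
  · have h0 : 0 < F * G := by positivity
    suffices F ^ (1 - a) * G ^ (1 - a) * d ^ (-(6 * a)) ≤ G ^ 2 * hlsK a (G ^ (1/3 : ℝ) * d) by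
      linarith
    unfold hlsK
    split_ifs with h
    · have e : G ^ 2 * (G ^ (1/3 : ℝ) * d) ^ (-(6 * a)) = G ^ (1 - a) * G ^ (1 - a) * d ^ (-(6 * a)) := by
        rw [Real.mul_rpow (by positivity) hd.le, ← Real.rpow_mul hG.le, ← Real.rpow_natCast,
          ← mul_assoc, ← Real.rpow_add hG, ← Real.rpow_add hG]
        congr 2; push_cast; ring
      rw [e]
      have : F ^ (1 - a) ≤ G ^ (1 - a) := Real.rpow_le_rpow hF.le hFG (by linarith)
      gcongr
    · have e : G ^ 2 * (G ^ (1/3 : ℝ) * d) ^ (-6 : ℝ) = (d ^ (-6 : ℝ)) ^ (1 - a) * d ^ (-(6 * a)) := by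
        rw [Real.mul_rpow (by positivity) hd.le, ← Real.rpow_mul hG.le, ← Real.rpow_natCast,
          ← mul_assoc, ← Real.rpow_add hG, ← Real.rpow_mul hd.le, ← Real.rpow_add hd]
        have e1 : ((2:ℕ):ℝ) + 1/3 * (-6) = 0 := by norm_num
        have e2 : (-6:ℝ) * (1 - a) + -(6 * a) = -6 := by ring
        rw [e1, e2, Real.rpow_zero, one_mul]
      rw [e, ← Real.mul_rpow hF.le hG.le]
      have : F * G ≤ d ^ (-6 : ℝ) := by
        rw [Real.rpow_neg hd.le, ← one_div, le_div_iff₀ hd60]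
        exact h1.le
      have : (F * G) ^ (1 - a) ≤ (d ^ (-6 : ℝ)) ^ (1 - a) := Real.rpow_le_rpow h0.le this (by linarith)
      gcongr

lemma hls_pt (a F G d : ℝ) (ha : 0 < a) (ha2 : a < 1/2) (hF : 0 ≤ F) (hG : 0 ≤ G)
    (hd : 0 ≤ d) :
    F ^ (1 - a) * G ^ (1 - a) * d ^ (-(6 * a)) ≤
      F * G + F ^ 2 * hlsK a (F ^ (1/3 : ℝ) * d) + G ^ 2 * hlsK a (G ^ (1/3 : ℝ) * d) := by
  have hKG := hlsK_nonneg a (G ^ (1/3 : ℝ) * d) (by positivity)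
  have hKF := hlsK_nonneg a (F ^ (1/3 : ℝ) * d) (by positivity)
  have hr : 0 ≤ F * G + F ^ 2 * hlsK a (F ^ (1/3 : ℝ) * d) + G ^ 2 * hlsK a (G ^ (1/3 : ℝ) * d) := by
    positivity
  rcases hF.eq_or_lt with h | hF'
  · subst h
    rw [Real.zero_rpow (by linarith)]; simpa using hr
  rcases hG.eq_or_lt with h | hG'
  · subst h
    rw [Real.zero_rpow (x := 1 - a) (by linarith)]; simpa using hr
  rcases hd.eq_or_lt with h | hd'
  · subst h
    rw [Real.zero_rpow (x := -(6 * a)) (by linarith)]; simpa using hr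
  have h1 : 0 ≤ F ^ 2 * hlsK a (F ^ (1/3 : ℝ) * d) := by positivity
  have h2 : 0 ≤ G ^ 2 * hlsK a (G ^ (1/3 : ℝ) * d) := by positivity
  rcases le_total F G with h | h
  · linarith [hls_pt_aux a F G d ha ha2 hF' hG' hd' h]
  · have := hls_pt_aux a G F d ha ha2 hG' hF' hd' h
    linarith [mul_comm (F ^ (1-a)) (G ^ (1-a)), mul_comm F G, congrArg (· * d ^ (-(6 * a))) (mul_comm (F ^ (1-a)) (G ^ (1-a)))]

def hlsI (a : ℝ) : ℝ≥0∞ := ∫⁻ z : E3, ENNReal.ofReal (hlsK a ‖z‖)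

lemma hlsI_lt_top (a : ℝ) (ha2 : a < 1/2) : hlsI a < ⊤ := by
  have : Integrable (fun z : E3 => hlsK a ‖z‖) := by
    rw [integrable_fun_norm_addHaar (volume : Measure E3)]
    have hdim : Module.finrank ℝ E3 = 3 := by simp
    rw [hdim, ← Ioc_union_Ioi_eq_Ioi (zero_le_one' ℝ)]
    refine IntegrableOn.union ?_ ?_
    · have h := (intervalIntegral.intervalIntegrable_rpow' (a := 0) (b := 1) (r := 2 - 6 * a) (by linarith)).1
      refine h.congr_fun (fun y hy => ?_) measurableSet_Ioc
      simp only [hlsK, if_pos hy.2, smul_eq_mul]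
      rw [← Real.rpow_natCast, ← Real.rpow_add hy.1]
      congr 1
    · have h := integrableOn_Ioi_rpow_of_lt (a := -4) (by norm_num) one_pos
      refine h.congr_fun (fun y hy => ?_) measurableSet_Ioi
      simp only [hlsK, if_neg (not_le.2 (mem_Ioi.1 hy)), smul_eq_mul]
      rw [← Real.rpow_natCast, ← Real.rpow_add (lt_trans one_pos hy)]
      norm_num
  exact this.lintegral_lt_top

lemma hls_scale_s11 (a r : ℝ) (hr : 0 < r) (y : E3) :
    ∫⁻ x : E3, ENNReal.ofReal (hlsK a (r * ‖x - y‖)) = ENNReal.ofReal ((r ^ 3)⁻¹) * hlsI a := by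
  have hm : Measurable (fun z : E3 => ENNReal.ofReal (hlsK a ‖z‖)) :=
    ((hlsK_measurable a).comp measurable_norm).ennreal_ofReal
  rw [lintegral_sub_right_eq_self (fun x : E3 => ENNReal.ofReal (hlsK a (r * ‖x‖))) y]
  have h := Measure.map_addHaar_smul (volume : Measure E3) hr.ne'
  have h2 := congrArg (fun μ => ∫⁻ z, ENNReal.ofReal (hlsK a ‖z‖) ∂μ) h
  rw [lintegral_map hm (measurable_const_smul r), lintegral_smul_measure] at h2
  simp only [norm_smul, Real.norm_eq_abs, abs_of_pos hr] at h2
  rw [h2]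
  have hdim : Module.finrank ℝ E3 = 3 := by simp
  rw [hdim, abs_of_pos (by positivity), hlsI, smul_eq_mul]

lemma hls_single (a G : ℝ) (hG : 0 ≤ G) (y : E3) :
    ∫⁻ x : E3, ENNReal.ofReal (G ^ 2 * hlsK a (G ^ (1/3 : ℝ) * ‖x - y‖)) ≤
      ENNReal.ofReal G * hlsI a := by
  rcases hG.eq_or_lt with h | hG'
  · subst h; simp
  · simp_rw [ENNReal.ofReal_mul (sq_nonneg G)]
    rw [lintegral_const_mul' _ _ ENNReal.ofReal_ne_top, hls_scale_s11 a _ (by positivity), ← mul_assoc,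
      ← ENNReal.ofReal_mul (sq_nonneg G)]
    have : (G ^ (1/3 : ℝ)) ^ 3 = G := by
      rw [← Real.rpow_natCast, ← Real.rpow_mul hG]; norm_num
    rw [this]
    apply le_of_eq
    congr 2
    field_simp

lemma hls_norm (a : ℝ) (ha : 0 < a) (ha2 : a < 1/2) (F G : E3 → ℝ) (hF : Measurable F)
    (hG : Measurable G) (hF0 : ∀ x, 0 ≤ F x) (hG0 : ∀ x, 0 ≤ G x)
    (hF1 : ∫⁻ x, ENNReal.ofReal (F x) = 1) (hG1 : ∫⁻ x, ENNReal.ofReal (G x) = 1) :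
    ∫⁻ y, ∫⁻ x, ENNReal.ofReal (F y ^ (1 - a) * G x ^ (1 - a) * ‖x - y‖ ^ (-(6 * a))) ≤
      1 + hlsI a + hlsI a := by
  have hK := hlsK_measurable a
  have m3 : Measurable (fun p : E3 × E3 =>
      ENNReal.ofReal (G p.2 ^ 2 * hlsK a (G p.2 ^ (1/3 : ℝ) * ‖p.2 - p.1‖))) := by fun_prop
  have m2 : Measurable (fun p : E3 × E3 =>
      ENNReal.ofReal (F p.1 ^ 2 * hlsK a (F p.1 ^ (1/3 : ℝ) * ‖p.2 - p.1‖))) := by fun_prop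
  have m1 : Measurable (fun p : E3 × E3 => ENNReal.ofReal (F p.1) * ENNReal.ofReal (G p.2)) := by
    fun_prop
  calc _ ≤ ∫⁻ y, ∫⁻ x, (ENNReal.ofReal (F y) * ENNReal.ofReal (G x)
        + ENNReal.ofReal (F y ^ 2 * hlsK a (F y ^ (1/3 : ℝ) * ‖x - y‖)))
        + ENNReal.ofReal (G x ^ 2 * hlsK a (G x ^ (1/3 : ℝ) * ‖x - y‖)) := by
        gcongr with y x
        rw [← ENNReal.ofReal_mul (hF0 y)]
        refine (ENNReal.ofReal_le_ofReal (hls_pt a _ _ _ ha ha2 (hF0 y) (hG0 x) (norm_nonneg _))).trans ?_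
        exact ENNReal.ofReal_add_le.trans (by gcongr; exact ENNReal.ofReal_add_le)
    _ = (∫⁻ y, ∫⁻ x, ENNReal.ofReal (F y) * ENNReal.ofReal (G x))
        + (∫⁻ y, ∫⁻ x, ENNReal.ofReal (F y ^ 2 * hlsK a (F y ^ (1/3 : ℝ) * ‖x - y‖)))
        + (∫⁻ y, ∫⁻ x, ENNReal.ofReal (G x ^ 2 * hlsK a (G x ^ (1/3 : ℝ) * ‖x - y‖))) := by
        rw [← lintegral_add_left m1.lintegral_prod_right',
          ← lintegral_add_right _ m3.lintegral_prod_right']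
        congr 1; ext y
        rw [lintegral_add_right _ (by fun_prop), lintegral_add_left (by fun_prop)]
    _ ≤ _ := by
      gcongr
      · simp_rw [lintegral_const_mul' _ _ ENNReal.ofReal_ne_top, hG1, mul_one, hF1]; rfl
      · refine (lintegral_mono (fun y => hls_single a (F y) (hF0 y) y)).trans ?_
        rw [lintegral_mul_const _ hF.ennreal_ofReal, hF1, one_mul]
      · rw [lintegral_lintegral_swap m3.aemeasurable]
        refine (lintegral_mono (fun y => ?_)).trans (b := ∫⁻ x, ENNReal.ofReal (G x) * hlsI a) ?_
        · refine le_of_eq_of_le (lintegral_congr fun z => ?_) (hls_single a (G y) (hG0 y) y)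
          rw [norm_sub_rev]
        rw [lintegral_mul_const _ hG.ennreal_ofReal, hG1, one_mul]

lemma hls_F (a : ℝ) (ha : 0 < a) (ha2 : a < 1/2) (F G : E3 → ℝ) (hF : Measurable F)
    (hG : Measurable G) (hF0 : ∀ x, 0 ≤ F x) (hG0 : ∀ x, 0 ≤ G x) :
    ∫⁻ y, ∫⁻ x, ENNReal.ofReal (F y ^ (1 - a) * G x ^ (1 - a) * ‖x - y‖ ^ (-(6 * a))) ≤
      (1 + hlsI a + hlsI a) * (∫⁻ x, ENNReal.ofReal (F x)) ^ (1 - a)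
        * (∫⁻ x, ENNReal.ofReal (G x)) ^ (1 - a) := by
  have h1a : 0 < 1 - a := by linarith
  set A := ∫⁻ x, ENNReal.ofReal (F x) with hA
  set B := ∫⁻ x, ENNReal.ofReal (G x) with hB
  have hC : (1 + hlsI a + hlsI a) ≠ 0 := by simp
  by_cases hA0 : A = 0
  · rw [hA, lintegral_eq_zero_iff hF.ennreal_ofReal] at hA0
    refine le_of_eq_of_le ?_ zero_le
    rw [← lintegral_zero (μ := (volume : Measure E3))]
    apply lintegral_congr_ae
    filter_upwards [hA0] with y hy
    have : F y = 0 := le_antisymm (by simpa using hy) (hF0 y)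
    simp [this, Real.zero_rpow h1a.ne']
  by_cases hB0 : B = 0
  · rw [hB, lintegral_eq_zero_iff hG.ennreal_ofReal] at hB0
    refine le_of_eq_of_le ?_ zero_le
    rw [← lintegral_zero (μ := (volume : Measure E3))]
    congr 1; ext y
    rw [← lintegral_zero (μ := (volume : Measure E3))]
    apply lintegral_congr_ae
    filter_upwards [hB0] with x hx
    have : G x = 0 := le_antisymm (by simpa using hx) (hG0 x)
    simp [this, Real.zero_rpow h1a.ne']
  have hA0' : A ^ (1 - a) ≠ 0 := by simp [ENNReal.rpow_eq_zero_iff, hA0]; intro _; linarith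
  have hB0' : B ^ (1 - a) ≠ 0 := by simp [ENNReal.rpow_eq_zero_iff, hB0]; intro _; linarith
  by_cases hAt : A = ⊤
  · rw [hAt, ENNReal.top_rpow_of_pos h1a, ENNReal.mul_top hC, ENNReal.top_mul hB0']; exact le_top
  by_cases hBt : B = ⊤
  · rw [hBt, ENNReal.top_rpow_of_pos h1a, ENNReal.mul_top (mul_ne_zero hC hA0')]; exact le_top
  obtain ⟨p, hp, hpA⟩ : ∃ p : ℝ, 0 < p ∧ A = ENNReal.ofReal p :=
    ⟨A.toReal, ENNReal.toReal_pos hA0 hAt, (ENNReal.ofReal_toReal hAt).symm⟩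
  obtain ⟨q, hq, hqB⟩ : ∃ q : ℝ, 0 < q ∧ B = ENNReal.ofReal q :=
    ⟨B.toReal, ENNReal.toReal_pos hB0 hBt, (ENNReal.ofReal_toReal hBt).symm⟩
  have key := hls_norm a ha ha2 (fun x => p⁻¹ * F x) (fun x => q⁻¹ * G x) (by fun_prop) (by fun_prop)
    (fun x => mul_nonneg (by positivity) (hF0 x)) (fun x => mul_nonneg (by positivity) (hG0 x))
    (by
      simp_rw [ENNReal.ofReal_mul (inv_nonneg.2 hp.le)]
      rw [lintegral_const_mul' _ _ ENNReal.ofReal_ne_top, ← hA, hpA,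
        ← ENNReal.ofReal_mul (inv_nonneg.2 hp.le), inv_mul_cancel₀ hp.ne', ENNReal.ofReal_one])
    (by
      simp_rw [ENNReal.ofReal_mul (inv_nonneg.2 hq.le)]
      rw [lintegral_const_mul' _ _ ENNReal.ofReal_ne_top, ← hB, hqB,
        ← ENNReal.ofReal_mul (inv_nonneg.2 hq.le), inv_mul_cancel₀ hq.ne', ENNReal.ofReal_one])
  have e : ∀ y x, ENNReal.ofReal (F y ^ (1 - a) * G x ^ (1 - a) * ‖x - y‖ ^ (-(6 * a))) =
      ENNReal.ofReal (p ^ (1 - a) * q ^ (1 - a)) * ENNReal.ofReal ((p⁻¹ * F y) ^ (1 - a) * (q⁻¹ * G x) ^ (1 - a) * ‖x - y‖ ^ (-(6 * a))) := by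
    intro y x
    rw [← ENNReal.ofReal_mul (by positivity), Real.mul_rpow (by positivity) (hF0 y),
      Real.mul_rpow (by positivity) (hG0 x), Real.inv_rpow hp.le, Real.inv_rpow hq.le]
    have : p ^ (1 - a) ≠ 0 := by positivity
    have : q ^ (1 - a) ≠ 0 := by positivity
    congr 1
    field_simp
  simp_rw [e, lintegral_const_mul' _ _ ENNReal.ofReal_ne_top]
  rw [hpA, hqB, ENNReal.ofReal_rpow_of_pos hp, ENNReal.ofReal_rpow_of_pos hq, mul_assoc,
    ← ENNReal.ofReal_mul (by positivity), mul_comm]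
  gcongr

theorem composite_hls_estimate_cross (α : ℝ) (hα : α ∈ Set.Ioo (0 : ℝ) 3) :
    ∃ C > 0, ∀ u φ ψ : E3 → ℝ,
      Measurable u → Measurable φ → Measurable ψ →
      (∫⁻ y : E3, ∫⁻ x : E3,
          (‖u y‖₊ : ℝ≥0∞) ^ (5 - α) * (‖φ y‖₊ : ℝ≥0∞)
            * (‖u x‖₊ : ℝ≥0∞) ^ (4 - α) * (‖φ x‖₊ : ℝ≥0∞) * (‖ψ x‖₊ : ℝ≥0∞)
            * (‖x - y‖₊ : ℝ≥0∞) ^ (-α))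
        ≤ ENNReal.ofReal C * L6norm u ^ (9 - 2*α) * L6norm φ ^ (2 : ℝ) * L6norm ψ := by
  obtain ⟨h0, h3⟩ := hα
  have hlt := hlsI_lt_top (α / 6) (by linarith)
  have hCt : 1 + hlsI (α / 6) + hlsI (α / 6) ≠ ⊤ := by finiteness
  have hs : 0 < 1 - α / 6 := by linarith
  have h6 : 0 < 6 - α := by linarith
  refine ⟨(1 + hlsI (α / 6) + hlsI (α / 6)).toReal, ENNReal.toReal_pos (by simp) hCt, ?_⟩
  intro u φ ψ hu hφ hψ
  rw [ENNReal.ofReal_toReal hCt]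
  set p : ℝ := (1 - α / 6)⁻¹ with hp
  have hp0 : 0 < p := inv_pos.2 hs
  have hps : p * (1 - α / 6) = 1 := inv_mul_cancel₀ hs.ne'
  have hps6 : p * (6 - α) = 6 := by linarith
  have hp6 : p = 6 / (6 - α) := by field_simp; linarith
  have main := hls_F (α / 6) (by linarith) (by linarith)
    (fun y => (|u y| ^ (5 - α) * |φ y|) ^ p)
    (fun x => (|u x| ^ (4 - α) * |φ x| * |ψ x|) ^ p) (by fun_prop) (by fun_prop)
    (fun _ => by positivity) (fun _ => by positivity)
  have ofn : ∀ r : ℝ, ENNReal.ofReal |r| = (‖r‖₊ : ℝ≥0∞) := fun r => by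
    rw [← Real.norm_eq_abs]; exact ofReal_norm r
  have e1 : (∫⁻ y : E3, ∫⁻ x : E3,
          (‖u y‖₊ : ℝ≥0∞) ^ (5 - α) * (‖φ y‖₊ : ℝ≥0∞)
            * (‖u x‖₊ : ℝ≥0∞) ^ (4 - α) * (‖φ x‖₊ : ℝ≥0∞) * (‖ψ x‖₊ : ℝ≥0∞)
            * (‖x - y‖₊ : ℝ≥0∞) ^ (-α)) =
      ∫⁻ y, ∫⁻ x, ENNReal.ofReal (((|u y| ^ (5 - α) * |φ y|) ^ p) ^ (1 - α / 6) *
        ((|u x| ^ (4 - α) * |φ x| * |ψ x|) ^ p) ^ (1 - α / 6) * ‖x - y‖ ^ (-(6 * (α / 6)))) := by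
    congr 1; ext y
    apply lintegral_congr_ae
    have : ∀ᵐ x : E3, x ≠ y := by
      rw [ae_iff]; simp
    filter_upwards [this] with x hx
    have hn : 0 < ‖x - y‖ := norm_pos_iff.2 (sub_ne_zero.2 hx)
    rw [← Real.rpow_mul (by positivity), ← Real.rpow_mul (by positivity), hps, Real.rpow_one,
      Real.rpow_one, ENNReal.ofReal_mul (by positivity), ENNReal.ofReal_mul (by positivity),
      ENNReal.ofReal_mul (by positivity), ENNReal.ofReal_mul (by positivity),
      ENNReal.ofReal_mul (by positivity), ← ENNReal.ofReal_rpow_of_nonneg (abs_nonneg _) (by linarith),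
      ← ENNReal.ofReal_rpow_of_nonneg (abs_nonneg _) (by linarith),
      ← ENNReal.ofReal_rpow_of_pos hn, ofn, ofn, ofn, ofn, ofn, ofReal_norm]
    have : -(6 * (α / 6)) = -α := by ring
    rw [this]
    simp only [enorm_eq_nnnorm]
    ring
  rw [e1]
  refine main.trans ?_
  have L6 : ∀ (f : E3 → ℝ) (s : ℝ), (∫⁻ x, (‖f x‖₊ : ℝ≥0∞) ^ (6:ℝ)) ^ (s / 6) = L6norm f ^ s := by
    intro f s
    rw [L6norm, ← ENNReal.rpow_mul]; congr 1; ring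
  have hm : ∀ f : E3 → ℝ, Measurable f → AEMeasurable (fun x => (‖f x‖₊ : ℝ≥0∞) ^ (6:ℝ)) volume :=
    fun f hf => by fun_prop
  have hw : ∀ w : ℝ, w / (6 - α) * (1 - α / 6) = w / 6 := fun w => by field_simp
  have hw6 : ∀ w : ℝ, 6 * (w / (6 - α)) = w * p := fun w => by rw [hp6]; ring
  have H1 : (∫⁻ y, ENNReal.ofReal ((|u y| ^ (5 - α) * |φ y|) ^ p)) ^ (1 - α / 6)
      ≤ L6norm u ^ (5 - α) * L6norm φ ^ (1 : ℝ) := by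
    have := ENNReal.lintegral_mul_norm_pow_le (hm u hu) (hm φ hφ) (p := (5 - α) / (6 - α))
      (q := 1 / (6 - α)) (div_nonneg (by linarith) h6.le) (by positivity) (by field_simp; ring)
    have := ENNReal.rpow_le_rpow this hs.le
    rw [ENNReal.mul_rpow_of_nonneg _ _ hs.le, ← ENNReal.rpow_mul, ← ENNReal.rpow_mul, hw, hw,
      L6, L6] at this
    convert this using 4 with y
    rw [← ENNReal.ofReal_rpow_of_nonneg (by positivity) hp0.le, ENNReal.ofReal_mul (by positivity),
      ← ENNReal.ofReal_rpow_of_nonneg (abs_nonneg _) (by linarith), ofn, ofn,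
      ENNReal.mul_rpow_of_nonneg _ _ hp0.le, ← ENNReal.rpow_mul, ← ENNReal.rpow_mul,
      ← ENNReal.rpow_mul, hw6, hw6, one_mul]
  have H2 : (∫⁻ x, ENNReal.ofReal ((|u x| ^ (4 - α) * |φ x| * |ψ x|) ^ p)) ^ (1 - α / 6)
      ≤ L6norm u ^ (4 - α) * L6norm φ ^ (1 : ℝ) * L6norm ψ ^ (1 : ℝ) := by
    have := ENNReal.lintegral_prod_norm_pow_le (μ := (volume : Measure E3)) (Finset.univ : Finset (Fin 3))
      (f := ![fun x => (‖u x‖₊ : ℝ≥0∞) ^ (6:ℝ), fun x => (‖φ x‖₊ : ℝ≥0∞) ^ (6:ℝ),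
        fun x => (‖ψ x‖₊ : ℝ≥0∞) ^ (6:ℝ)])
      (p := ![(4 - α) / (6 - α), 1 / (6 - α), 1 / (6 - α)])
      (by intro i _; fin_cases i; exacts [hm u hu, hm φ hφ, hm ψ hψ])
      (by simp [Fin.sum_univ_three]; field_simp; ring)
      (by
        intro i _
        have h4 : 0 ≤ (4 - α) / (6 - α) := div_nonneg (by linarith) h6.le
        have h1 : 0 ≤ 1 / (6 - α) := by positivity
        fin_cases i; exacts [h4, h1, h1])
    simp only [Fin.prod_univ_three, Matrix.cons_val_zero, Matrix.cons_val_one, Matrix.cons_val] at this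
    have := ENNReal.rpow_le_rpow this hs.le
    rw [ENNReal.mul_rpow_of_nonneg _ _ hs.le, ENNReal.mul_rpow_of_nonneg _ _ hs.le,
      ← ENNReal.rpow_mul, ← ENNReal.rpow_mul, ← ENNReal.rpow_mul, hw, hw,
      L6, L6, L6] at this
    convert this using 4 with y
    rw [← ENNReal.ofReal_rpow_of_nonneg (by positivity) hp0.le, ENNReal.ofReal_mul (by positivity),
      ENNReal.ofReal_mul (by positivity),
      ← ENNReal.ofReal_rpow_of_nonneg (abs_nonneg _) (by linarith), ofn, ofn, ofn,
      ENNReal.mul_rpow_of_nonneg _ _ hp0.le, ENNReal.mul_rpow_of_nonneg _ _ hp0.le,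
      ← ENNReal.rpow_mul, ← ENNReal.rpow_mul,
      ← ENNReal.rpow_mul, ← ENNReal.rpow_mul, hw6, hw6, one_mul]
  refine (mul_le_mul' (mul_le_mul' le_rfl H1) H2).trans (le_of_eq ?_)
  have e9 : L6norm u ^ (9 - 2 * α) = L6norm u ^ (5 - α) * L6norm u ^ (4 - α) := by
    rw [← ENNReal.rpow_add_of_nonneg _ _ (by linarith) (by linarith)]; congr 1; ring
  have e2 : L6norm φ ^ (2 : ℝ) = L6norm φ * L6norm φ := by
    rw [ENNReal.rpow_two, sq]
  rw [e9, e2, ENNReal.rpow_one, ENNReal.rpow_one]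
  ring

end
end
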